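/- arXiv:2010.02671 — 5 statements merged into one kernel-verified Lean document; each statement's English description precedes it below -/
import Mathlib

section
/- Let 0 < q < 1/2, 0 ≤ γ ≤ 1, p := 1 - q, q'(q,γ) := (((1 + pq)(p - q) + pq)·q - (1 - γ)·p²·q·(p - q))/(p²q + p - q) and δ(q) := (1 - 4q² + 2q³)/(1 - q - 2q² + q³). Then q'(q,γ) ≤ q·δ(q), with equality if and only if γ = 1; equivalently, before the first difficulty adjustment the selfish miner's revenue ratio q'/δ is at most the honest revenue ratio q, with equality only for γ = 1. -/
/-- The apparent hashrate `q'` of selfish mining is at most `q·δ`,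
with equality if and only if the connectivity `γ` equals 1; i.e. before the first
difficulty adjustment the selfish miner's revenue ratio `q'/δ` is at most the honest
revenue ratio `q`, with equality only for `γ = 1`. -/
theorem selfish_mining_unprofitable_before_adjustment (q γ : ℝ)
    (hq0 : 0 < q) (hq1 : q < 1/2) (hγ0 : 0 ≤ γ) (hγ1 : γ ≤ 1) :
    (((1 + (1 - q)*q) * ((1 - q) - q) + (1 - q)*q) * q
        - (1 - γ) * (1 - q)^2 * q * ((1 - q) - q)) / ((1 - q)^2*q + (1 - q) - q)
      ≤ q * ((1 - 4*q^2 + 2*q^3) / (1 - q - 2*q^2 + q^3)) ∧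
    ((((1 + (1 - q)*q) * ((1 - q) - q) + (1 - q)*q) * q
        - (1 - γ) * (1 - q)^2 * q * ((1 - q) - q)) / ((1 - q)^2*q + (1 - q) - q)
      = q * ((1 - 4*q^2 + 2*q^3) / (1 - q - 2*q^2 + q^3)) ↔ γ = 1) := by
  have hD : (1 - q)^2*q + (1 - q) - q = 1 - q - 2*q^2 + q^3 := by ring
  have hDpos : 0 < 1 - q - 2*q^2 + q^3 := by
    rw [← hD]
    have : 0 ≤ (1 - q)^2*q := by positivity
    linarith
  have hK : 0 < (1 - q)^2 * q * ((1 - q) - q) := by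
    have h1 : 0 < 1 - q := by linarith
    have h2 : 0 < (1 - q) - q := by linarith
    positivity
  rw [hD, ← mul_div_assoc, div_le_div_iff_of_pos_right hDpos, div_left_inj' hDpos.ne']
  refine ⟨?_, fun h ↦ ?_, ?_⟩
  · linarith [mul_nonneg (sub_nonneg.2 hγ1) hK.le]
  · have h0 : (1 - γ) * ((1 - q)^2 * q * ((1 - q) - q)) = 0 := by linarith
    linarith [(mul_eq_zero.1 h0).resolve_right hK.ne']
  · rintro rfl
    ring
end

section
/- Let 0 < q < 1/2, 0 ≤ γ ≤ 1, p := 1 - q, q' := (((1 + pq)(p - q) + pq)·q - (1 - γ)·p²·q·(p - q))/(p²q + p - q) and δ := (1 - 4q² + 2q³)/(1 - q - 2q² + q³). Then the apparent hashrate of the intermittent selfish mining strategy, q'' := (q + q')/(δ + 1/δ), satisfies the closed-form identity q'' = q(1 - 4q² + 2q³)(1 + γ + (3 - 4γ)q + (5γ - 11)q² + (5 - 2γ)q³)/(2 - 2q - 11q² + 10q³ + 18q⁴ - 20q⁵ + 5q⁶). -/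
/-- Closed form for the apparent hashrate `q'' = (q + q')/(δ + 1/δ)` of the intermittent
selfish mining strategy. -/
theorem ism_apparent_hashrate_closed_form (q γ : ℝ) (hq0 : 0 < q) (hq1 : q < 1/2)
    (hγ0 : 0 ≤ γ) (hγ1 : γ ≤ 1) :
    let p : ℝ := 1 - q
    let q' : ℝ := (((1 + p*q) * (p - q) + p*q) * q - (1 - γ) * p^2 * q * (p - q))
        / (p^2*q + p - q)
    let δ : ℝ := (1 - 4*q^2 + 2*q^3) / (1 - q - 2*q^2 + q^3)
    (q + q') / (δ + 1/δ)
      = q * (1 - 4*q^2 + 2*q^3)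
          * (1 + γ + (3 - 4*γ)*q + (5*γ - 11)*q^2 + (5 - 2*γ)*q^3)
        / (2 - 2*q - 11*q^2 + 10*q^3 + 18*q^4 - 20*q^5 + 5*q^6) := by
  intro p q' δ
  have hA : 0 < 1 - 4*q^2 + 2*q^3 := by
    nlinarith [pow_pos hq0 3]
  have hB : 0 < 1 - q - 2*q^2 + q^3 := by
    nlinarith [mul_nonneg hq0.le (sq_nonneg (1 - q))]
  have hC : 2 - 2*q - 11*q^2 + 10*q^3 + 18*q^4 - 20*q^5 + 5*q^6
      = (1 - 4*q^2 + 2*q^3)^2 + (1 - q - 2*q^2 + q^3)^2 := by ring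
  have hden : p^2*q + p - q = 1 - q - 2*q^2 + q^3 := by simp only [p]; ring
  have hδ : δ + 1/δ = ((1 - 4*q^2 + 2*q^3)^2 + (1 - q - 2*q^2 + q^3)^2)
      / ((1 - 4*q^2 + 2*q^3) * (1 - q - 2*q^2 + q^3)) := by
    simp only [δ]
    generalize 1 - 4*q^2 + 2*q^3 = A at hA ⊢
    generalize 1 - q - 2*q^2 + q^3 = B at hB ⊢
    field_simp
  have hnum : q + q' = q * (1 + γ + (3 - 4*γ)*q + (5*γ - 11)*q^2 + (5 - 2*γ)*q^3)
      / (1 - q - 2*q^2 + q^3) := by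
    simp only [q', hden]
    rw [eq_div_iff hB.ne', add_mul, div_mul_cancel₀ _ hB.ne']
    simp only [p]
    ring
  rw [hnum, hδ, hC]
  generalize 1 - 4*q^2 + 2*q^3 = A at hA ⊢
  generalize 1 - q - 2*q^2 + q^3 = B at hB ⊢
  have hAB : 0 < A^2 + B^2 := by positivity
  field_simp
end

section
/- Let 0 < q < 1/2, 0 ≤ γ ≤ 1, p := 1 - q, q' := (((1 + pq)(p - q) + pq)·q - (1 - γ)·p²·q·(p - q))/(p²q + p - q), δ := (1 - 4q² + 2q³)/(1 - q - 2q² + q³), and q'' := (q + q')/(δ + 1/δ). If q'' > q then q'' < q'; that is, whenever intermittent selfish mining is more profitable than honest mining, selfish mining is more profitable than intermittent selfish mining. -/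
theorem two_lt_add_one_div {x : ℝ} (hx : 1 < x) : 2 < x + 1 / x := by
  have hx0 : 0 < x := by linarith
  have h : x + 1 / x - 2 = (x - 1)^2 / x := by
    field_simp
    ring
  have : 0 < (x - 1)^2 / x := div_pos (pow_pos (by linarith) 2) hx0
  linarith

/-- If `(a + b) / s` with `s > 2` exceeds `a > 0`, then it is less than `b`. -/
theorem weighted_mean_lt_of_lt {a b s : ℝ} (ha : 0 < a) (hs : 2 < s)
    (h : a < (a + b) / s) : (a + b) / s < b := by
  have hs0 : 0 < s := by linarith
  rw [lt_div_iff₀ hs0] at h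
  rw [div_lt_iff₀ hs0]
  have hab : a < b := by nlinarith
  nlinarith

/-- Whenever intermittent selfish mining is more profitable than honest mining,
plain selfish mining is more profitable than intermittent selfish mining. -/
theorem sm_beats_ism_when_ism_beats_hm (q γ : ℝ) (hq0 : 0 < q) (hq1 : q < 1/2)
    (hγ0 : 0 ≤ γ) (hγ1 : γ ≤ 1) :
    let p : ℝ := 1 - q
    let q' : ℝ := (((1 + p*q) * (p - q) + p*q) * q - (1 - γ) * p^2 * q * (p - q))
        / (p^2*q + p - q)
    let δ : ℝ := (1 - 4*q^2 + 2*q^3) / (1 - q - 2*q^2 + q^3)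
    let q'' : ℝ := (q + q') / (δ + 1/δ)
    q'' > q → q'' < q' := by
  intro p q' δ q'' h
  have hD : 0 < 1 - q - 2*q^2 + q^3 := by
    nlinarith [mul_nonneg hq0.le (sq_nonneg (1 - q))]
  have hDN : 1 - q - 2*q^2 + q^3 < 1 - 4*q^2 + 2*q^3 := by
    have : 0 < q * (1 - q)^2 := mul_pos hq0 (pow_pos (by linarith) 2)
    nlinarith
  exact weighted_mean_lt_of_lt hq0 (two_lt_add_one_div ((one_lt_div hD).2 hDN)) h
end

section
/- Let γ = 0 and for 0 < q < 1/2 define q''(q) := q(1 - 4q² + 2q³)(1 + 3q - 11q² + 5q³)/(2 - 2q - 11q² + 10q³ + 18q⁴ - 20q⁵ + 5q⁶). Then there exists q* with 0.3650 < q* < 0.3651 such that q''(q*) = q*; i.e., the profitability threshold of intermittent selfish mining against honest mining at zero connectivity is approximately 0.365078. -/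
/-- At connectivity `γ = 0`, the profitability threshold of intermittent selfish mining
against honest mining is a fixed point `q*` of the apparent-hashrate map, with
`0.3650 < q* < 0.3651` (approximately `0.365078`). -/
theorem ism_threshold_gamma_zero :
    ∃ qstar : ℝ, 0.3650 < qstar ∧ qstar < 0.3651 ∧
      qstar * (1 - 4*qstar^2 + 2*qstar^3) * (1 + 3*qstar - 11*qstar^2 + 5*qstar^3)
          / (2 - 2*qstar - 11*qstar^2 + 10*qstar^3 + 18*qstar^4 - 20*qstar^5 + 5*qstar^6)
        = qstar := by
  let f : ℝ → ℝ := fun q => (1 - 4*q^2 + 2*q^3) * (1 + 3*q - 11*q^2 + 5*q^3)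
    - (2 - 2*q - 11*q^2 + 10*q^3 + 18*q^4 - 20*q^5 + 5*q^6)
  have hf : ContinuousOn f (Set.Icc 0.3650 0.3651) := by
    unfold f
    fun_prop
  have hmem : (0 : ℝ) ∈ Set.Ioo (f 0.3650) (f 0.3651) := by
    constructor <;> norm_num [f]
  obtain ⟨q, ⟨hl, hu⟩, hq⟩ := intermediate_value_Ioo (by norm_num) hf hmem
  refine ⟨q, hl, hu, ?_⟩
  have hq0 : 0 < q := lt_trans (by norm_num) hl
  have hq2 : q^2 < 0.3651^2 := by gcongr
  have hq3 : 0 < q^3 := by positivity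
  have hA : 0 < 1 - 4*q^2 + 2*q^3 := by
    norm_num at hq2
    linarith
  have hB : 0 < 1 + 3*q - 11*q^2 + 5*q^3 := by
    norm_num at hl hq2
    linarith
  rw [← sub_eq_zero.mp hq, mul_assoc, mul_div_cancel_right₀ _ (mul_pos hA hB).ne']
end

section
/- For all q ∈ [0, 1/2], the polynomial P(q) := (2 - q)(q³ - 2q² - q + 1) - (2 - 2q + q²)·q·(2q³ - 4q² + 1) is strictly positive; equivalently, since q³ - 2q² - q + 1 > 0 and 2 - 2q + q² > 0 on this interval, (2 - q)/(2 - 2q + q²) > q(2q³ - 4q² + 1)/(q³ - 2q² - q + 1) for 0 < q < 1/2. -/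
/-- In the variable `t = 1/2 - q`, the comparison polynomial is
`1/32 + 17/8 t + t² (33/8 - t²/2 - 2 t³ - 2 t⁴)`. -/
theorem anm_comparison_polynomial_pos {q : ℝ} (h0 : 0 ≤ q) (h1 : q ≤ 1/2) :
    0 < (2 - q) * (q^3 - 2*q^2 - q + 1) - (2 - 2*q + q^2) * q * (2*q^3 - 4*q^2 + 1) := by
  obtain ⟨t, rfl⟩ : ∃ t, q = 1/2 - t := ⟨1/2 - q, by ring⟩
  have ht : 0 ≤ t := by linarith
  have ht1 : t ≤ 1 := by linarith
  have h2 : t^2 ≤ 1/4 := by nlinarith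
  have h3 : t^3 ≤ t^2 := pow_le_pow_of_le_one ht ht1 (by norm_num)
  have h4 : t^4 ≤ t^2 := pow_le_pow_of_le_one ht ht1 (by norm_num)
  have key : 0 ≤ t^2 * (33/8 - t^2/2 - 2*t^3 - 2*t^4) :=
    mul_nonneg (sq_nonneg t) (by linarith)
  linear_combination key + 17/8 * ht + (by norm_num : (0 : ℝ) < 1/32)

theorem selfish_mining_denominator_pos {q : ℝ} (h0 : 0 ≤ q) (h1 : q ≤ 1/2) :
    0 < q^3 - 2*q^2 - q + 1 := by
  have hq : q^2 ≤ q / 2 := by nlinarith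
  rcases h0.eq_or_lt with rfl | hpos
  · norm_num
  · linarith [pow_pos hpos 3]

theorem anm_denominator_pos (q : ℝ) : 0 < 2 - 2*q + q^2 := by
  linarith [sq_nonneg (q - 1), show (q - 1)^2 = q^2 - 2*q + 1 by ring]

/-- The polynomial `P(q)` comparing alternate network mining with selfish mining at
`γ = 1` is strictly positive on `[0, 1/2]`; equivalently, since the denominators are
positive there, `(2 - q)/(2 - 2q + q²) > q(2q³ - 4q² + 1)/(q³ - 2q² - q + 1)` for
`0 < q < 1/2`. -/
theorem anm_beats_selfish_mining :
    (∀ q : ℝ, 0 ≤ q → q ≤ 1/2 →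
      0 < (2 - q) * (q^3 - 2*q^2 - q + 1) - (2 - 2*q + q^2) * q * (2*q^3 - 4*q^2 + 1)) ∧
    (∀ q : ℝ, 0 ≤ q → q ≤ 1/2 → 0 < q^3 - 2*q^2 - q + 1 ∧ 0 < 2 - 2*q + q^2) ∧
    (∀ q : ℝ, 0 < q → q < 1/2 →
      (2 - q) / (2 - 2*q + q^2) > q * (2*q^3 - 4*q^2 + 1) / (q^3 - 2*q^2 - q + 1)) := by
  refine ⟨fun q h0 h1 => anm_comparison_polynomial_pos h0 h1,
    fun q h0 h1 => ⟨selfish_mining_denominator_pos h0 h1, anm_denominator_pos q⟩,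
    fun q h0 h1 => ?_⟩
  rw [gt_iff_lt, div_lt_div_iff₀ (selfish_mining_denominator_pos h0.le h1.le)
    (anm_denominator_pos q)]
  linarith [anm_comparison_polynomial_pos h0.le h1.le]
end
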